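/- (States with maximally mixed marginals and prescribed mutual information.) For every integer d ≥ 1 and every real y with 0 ≤ y ≤ 2·ln d, there exists a density matrix ρ on the index type Fin d × Fin d such that both marginals ρ_S and ρ_W equal (1/d)·I, and the quantum mutual information S(ρ_S) + S(ρ_W) − S(ρ) equals y. -/

import Mathlib

open Matrix Kronecker BigOperators ComplexOrder

noncomputable section

/-- A density matrix: positive semidefinite with unit trace. -/
def IsDensityMatrix {ι : Type*} [Fintype ι] (ρ : Matrix ι ι ℂ) : Prop :=
  ρ.PosSemidef ∧ ρ.trace = 1

/-- Von Neumann entropy of a (Hermitian) matrix: `∑ i, negMulLog (λ i)`. -/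
noncomputable def vnEntropy {ι : Type*} [Fintype ι] [DecidableEq ι] (ρ : Matrix ι ι ℂ) : ℝ :=
  if h : ρ.IsHermitian then ∑ i, Real.negMulLog (h.eigenvalues i) else 0

/-- Partial trace over the first tensor factor. -/
def ptraceFst {ιS ιW : Type*} [Fintype ιS] (ρ : Matrix (ιS × ιW) (ιS × ιW) ℂ) :
    Matrix ιW ιW ℂ :=
  fun b b' => ∑ a, ρ (a, b) (a, b')

/-- Partial trace over the second tensor factor. -/
def ptraceSnd {ιS ιW : Type*} [Fintype ιW] (ρ : Matrix (ιS × ιW) (ιS × ιW) ℂ) :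
    Matrix ιS ιS ℂ :=
  fun a a' => ∑ b, ρ (a, b) (a', b)

theorem vnEntropy_eq_sum_of_charpoly {ι : Type*} [Fintype ι] [DecidableEq ι]
    {A : Matrix ι ι ℂ} (hA : A.IsHermitian) (p : ι → ℝ)
    (h : A.charpoly = ∏ i, (Polynomial.X - Polynomial.C (p i : ℂ))) :
    vnEntropy A = ∑ i, Real.negMulLog (p i) := by
  have hroots := hA.roots_charpoly_eq_eigenvalues
  rw [h, Polynomial.roots_prod _ _ (by
    simp [Finset.prod_ne_zero_iff, Polynomial.X_sub_C_ne_zero])] at hroots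
  have hsum := congrArg (fun s : Multiset ℂ => (s.map fun z => Real.negMulLog z.re).sum) hroots
  simp only [Polynomial.roots_X_sub_C, Multiset.bind_singleton, Multiset.map_map,
    Function.comp_apply] at hsum
  rw [vnEntropy, dif_pos hA]
  exact hsum.symm

theorem Matrix.IsHermitian.smul_add_smul_one {ι : Type*} [DecidableEq ι]
    {P : Matrix ι ι ℂ} (hP : P.IsHermitian) (a b : ℝ) :
    ((a : ℂ) • P + (b : ℂ) • (1 : Matrix ι ι ℂ)).IsHermitian := by
  simp [Matrix.IsHermitian, Matrix.conjTranspose_add, Matrix.conjTranspose_smul, hP.eq]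

theorem vnEntropy_smul_add_smul_one {ι : Type*} [Fintype ι] [DecidableEq ι]
    {P : Matrix ι ι ℂ} (hP : P.IsHermitian) (a b : ℝ) :
    vnEntropy ((a : ℂ) • P + (b : ℂ) • (1 : Matrix ι ι ℂ)) =
      ∑ i, Real.negMulLog (a * hP.eigenvalues i + b) := by
  refine vnEntropy_eq_sum_of_charpoly (hP.smul_add_smul_one a b) _ ?_
  have hconj : (a : ℂ) • P + (b : ℂ) • (1 : Matrix ι ι ℂ) =
      Unitary.conjStarAlgAut ℂ _ hP.eigenvectorUnitary
        (diagonal fun i => ((a * hP.eigenvalues i + b : ℝ) : ℂ)) := by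
    have hdiag : (diagonal fun i => ((a * hP.eigenvalues i + b : ℝ) : ℂ)) =
        (a : ℂ) • diagonal (RCLike.ofReal ∘ hP.eigenvalues) + (b : ℂ) • (1 : Matrix ι ι ℂ) := by
      ext i j
      by_cases hij : i = j <;> simp [hij]
    rw [hdiag, map_add, map_smul, map_smul, map_one, ← hP.spectral_theorem]
  rw [hconj, Unitary.conjStarAlgAut_apply, charpoly_mul_comm, ← mul_assoc]
  simp [charpoly_diagonal]

theorem vnEntropy_smul_one {ι : Type*} [Fintype ι] [DecidableEq ι] (b : ℝ) :
    vnEntropy ((b : ℂ) • (1 : Matrix ι ι ℂ)) = Fintype.card ι * Real.negMulLog b := by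
  have h := vnEntropy_smul_add_smul_one (Matrix.isHermitian_one (n := ι) (α := ℂ)) 0 b
  simpa using h

theorem eigenvalues_eq_zero_or_one {ι : Type*} [Fintype ι] [DecidableEq ι]
    {P : Matrix ι ι ℂ} (hP : P.IsHermitian) (hPP : P * P = P) (i : ι) :
    hP.eigenvalues i = 0 ∨ hP.eigenvalues i = 1 := by
  simpa using IsIdempotentElem.spectrum_subset ℝ hPP (hP.eigenvalues_mem_spectrum_real i)

/-- The projection onto the maximally entangled vector `d^{-1/2} ∑ i, e i ⊗ e i`. -/
def maxEntangled (d : ℕ) : Matrix (Fin d × Fin d) (Fin d × Fin d) ℂ :=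
  fun x y => if x.1 = x.2 ∧ y.1 = y.2 then 1 / (d : ℂ) else 0

theorem maxEntangled_isHermitian (d : ℕ) : (maxEntangled d).IsHermitian := by
  ext x y
  by_cases hx : x.1 = x.2 <;> by_cases hy : y.1 = y.2 <;> simp [maxEntangled, hx, hy]

theorem maxEntangled_mul_self {d : ℕ} (hd : 1 ≤ d) :
    maxEntangled d * maxEntangled d = maxEntangled d := by
  have hd' : (d : ℂ) ≠ 0 := by exact_mod_cast (by omega : d ≠ 0)
  ext x y
  by_cases hx : x.1 = x.2 <;> by_cases hy : y.1 = y.2 <;>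
    simp [Matrix.mul_apply, maxEntangled, hx, hy, Fintype.sum_prod_type, hd']

theorem maxEntangled_posSemidef {d : ℕ} (hd : 1 ≤ d) : (maxEntangled d).PosSemidef := by
  have h := Matrix.posSemidef_conjTranspose_mul_self (maxEntangled d)
  rwa [(maxEntangled_isHermitian d).eq, maxEntangled_mul_self hd] at h

/-- The isotropic state interpolating between the maximally mixed state at `t = 0` and the
maximally entangled state at `t = 1`. -/
def isotropicState (d : ℕ) (t : ℝ) : Matrix (Fin d × Fin d) (Fin d × Fin d) ℂ :=
  (t : ℂ) • maxEntangled d + (((1 - t) / (d : ℝ) ^ 2 : ℝ) : ℂ) • 1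

theorem ptraceSnd_isotropicState {d : ℕ} (hd : 1 ≤ d) (t : ℝ) :
    ptraceSnd (isotropicState d t) = (1 / (d : ℂ)) • (1 : Matrix (Fin d) (Fin d) ℂ) := by
  have hd' : (d : ℂ) ≠ 0 := by exact_mod_cast (by omega : d ≠ 0)
  ext a a'
  by_cases h : a = a'
  · subst h
    simp [ptraceSnd, isotropicState, maxEntangled, Finset.sum_add_distrib]
    field_simp
    ring
  · have h' : ∀ b, ¬ (a = b ∧ a' = b) := fun b hb => h (hb.1.trans hb.2.symm)
    simp [ptraceSnd, isotropicState, maxEntangled, h, h']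

theorem ptraceFst_isotropicState {d : ℕ} (hd : 1 ≤ d) (t : ℝ) :
    ptraceFst (isotropicState d t) = (1 / (d : ℂ)) • (1 : Matrix (Fin d) (Fin d) ℂ) := by
  have hd' : (d : ℂ) ≠ 0 := by exact_mod_cast (by omega : d ≠ 0)
  ext b b'
  by_cases h : b = b'
  · subst h
    simp [ptraceFst, isotropicState, maxEntangled, Finset.sum_add_distrib]
    field_simp
    ring
  · have h' : ∀ a, ¬ (a = b ∧ a = b') := fun a ha => h (ha.1.symm.trans ha.2)
    simp [ptraceFst, isotropicState, maxEntangled, h, h']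

theorem trace_ptraceSnd {ιS ιW : Type*} [Fintype ιS] [Fintype ιW]
    (ρ : Matrix (ιS × ιW) (ιS × ιW) ℂ) : (ptraceSnd ρ).trace = ρ.trace := by
  simp [Matrix.trace, ptraceSnd, Fintype.sum_prod_type]

theorem isDensityMatrix_isotropicState {d : ℕ} (hd : 1 ≤ d) {t : ℝ} (ht : t ∈ Set.Icc (0 : ℝ) 1) :
    IsDensityMatrix (isotropicState d t) := by
  have hd' : (d : ℂ) ≠ 0 := by exact_mod_cast (by omega : d ≠ 0)
  refine ⟨?_, ?_⟩
  · have hb : 0 ≤ (1 - t) / (d : ℝ) ^ 2 := div_nonneg (by linarith [ht.2]) (by positivity)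
    exact ((maxEntangled_posSemidef hd).smul (Complex.zero_le_real.mpr ht.1)).add
      (Matrix.PosSemidef.one.smul (Complex.zero_le_real.mpr hb))
  · rw [← trace_ptraceSnd, ptraceSnd_isotropicState hd]
    simp [hd']

theorem natCast_mul_negMulLog_one_div {n : ℕ} (hn : n ≠ 0) :
    (n : ℝ) * Real.negMulLog (1 / n) = Real.log n := by
  have hn' : (n : ℝ) ≠ 0 := by exact_mod_cast hn
  rw [Real.negMulLog, one_div, Real.log_inv]
  field_simp

theorem exists_vnEntropy_isotropicState {d : ℕ} (hd : 1 ≤ d) {s : ℝ} (hs0 : 0 ≤ s)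
    (hs1 : s ≤ 2 * Real.log d) :
    ∃ t ∈ Set.Icc (0 : ℝ) 1, vnEntropy (isotropicState d t) = s := by
  have hP := maxEntangled_isHermitian d
  let f : ℝ → ℝ := fun t =>
    ∑ i, Real.negMulLog (t * hP.eigenvalues i + (1 - t) / (d : ℝ) ^ 2)
  have hf : Continuous f := by fun_prop
  have hf0 : f 0 = 2 * Real.log d := by
    have h := natCast_mul_negMulLog_one_div (n := d ^ 2) (by positivity)
    rw [Nat.cast_pow, Real.log_pow, Nat.cast_ofNat] at h
    simpa [f, sq] using h
  have hf1 : f 1 = 0 := by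
    refine Finset.sum_eq_zero fun i _ => ?_
    rcases eigenvalues_eq_zero_or_one hP (maxEntangled_mul_self hd) i with h | h <;> simp [h]
  obtain ⟨t, ht, hts⟩ := intermediate_value_Icc' (zero_le_one' ℝ) hf.continuousOn
    (show s ∈ Set.Icc (f 1) (f 0) from ⟨hf1.trans_le hs0, hs1.trans_eq hf0.symm⟩)
  exact ⟨t, ht, (vnEntropy_smul_add_smul_one hP _ _).trans hts⟩

/-- For every `0 ≤ y ≤ 2 ln d` there exists a bipartite state with both marginals
maximally mixed whose mutual information is exactly `y`. -/
theorem stmt13 (d : ℕ) (hd : 1 ≤ d) (y : ℝ) (hy0 : 0 ≤ y) (hy1 : y ≤ 2 * Real.log d) :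
    ∃ ρ : Matrix (Fin d × Fin d) (Fin d × Fin d) ℂ,
      IsDensityMatrix ρ ∧
      ptraceSnd ρ = (1 / (d : ℂ)) • (1 : Matrix (Fin d) (Fin d) ℂ) ∧
      ptraceFst ρ = (1 / (d : ℂ)) • (1 : Matrix (Fin d) (Fin d) ℂ) ∧
      vnEntropy (ptraceSnd ρ) + vnEntropy (ptraceFst ρ) - vnEntropy ρ = y := by
  obtain ⟨t, ht, hS⟩ := exists_vnEntropy_isotropicState hd
    (sub_nonneg.mpr hy1) (sub_le_self _ hy0)
  have hmarg : vnEntropy ((1 / (d : ℂ)) • (1 : Matrix (Fin d) (Fin d) ℂ)) = Real.log d := by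
    have h := vnEntropy_smul_one (ι := Fin d) (1 / d)
    rw [Fintype.card_fin, natCast_mul_negMulLog_one_div (by omega)] at h
    simpa using h
  refine ⟨isotropicState d t, isDensityMatrix_isotropicState hd ht,
    ptraceSnd_isotropicState hd t, ptraceFst_isotropicState hd t, ?_⟩
  rw [ptraceSnd_isotropicState hd, ptraceFst_isotropicState hd, hmarg, hS]
  ring
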